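/- arXiv:math/0204167 — 4 statements merged into one kernel-verified Lean document; each statement's English description precedes it below -/
import Mathlib

section
/- Splitting theorem (Theorem 1): the rays started from the points of B̄ are pairwise disjoint and cover A. Precisely: (a) for all a₀, b₀ ∈ B̄ with a₀ ≠ b₀, r_{a₀} ∩ r_{b₀} = ∅; (b) the union ⋃_{a₀ ∈ B̄} r_{a₀} equals A. -/
/-- Orbits of an injective self-map of `s` that start outside its image meet only if their
starting points agree. -/
theorem eq_of_iterate_eq_of_notMem_image {α : Type*} {f : α → α} {s : Set α}
    (hinj : Set.InjOn f s) (hmaps : Set.MapsTo f s s) {a b : α} (ha : a ∈ s \ f '' s)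
    (hb : b ∈ s \ f '' s) {n m : ℕ} (h : f^[n] a = f^[m] b) : a = b := by
  induction n generalizing m with
  | zero =>
    cases m with
    | zero => exact h
    | succ m =>
      rw [Function.iterate_succ_apply'] at h
      exact absurd ⟨_, hmaps.iterate m hb.1, h.symm⟩ ha.2
  | succ n ih =>
    rw [Function.iterate_succ_apply'] at h
    cases m with
    | zero => exact absurd ⟨_, hmaps.iterate n ha.1, h⟩ hb.2
    | succ m =>
      rw [Function.iterate_succ_apply'] at h
      exact ih (hinj (hmaps.iterate n ha.1) (hmaps.iterate m hb.1) h)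

/-- If `f` strictly increases every point of `s`, then every point of `s` lies on an orbit
starting outside the image of `s`. -/
theorem exists_iterate_eq_of_forall_lt {α : Type*} [Preorder α] [WellFoundedLT α] {f : α → α}
    {s : Set α} (hlt : ∀ x ∈ s, x < f x) {x : α} (hx : x ∈ s) :
    ∃ a ∈ s \ f '' s, ∃ n, f^[n] a = x := by
  induction x using WellFoundedLT.induction with
  | ind x ih =>
    by_cases hxf : x ∈ f '' s
    · obtain ⟨y, hy, rfl⟩ := hxf
      obtain ⟨a, ha, n, rfl⟩ := ih y (hlt y hy) hy
      exact ⟨a, ha, n + 1, Function.iterate_succ_apply' f n a⟩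
    · exact ⟨x, ⟨hx, hxf⟩, 0, rfl⟩

/-- A function strictly increasing on the positive integers with `1 < g 1` satisfies `n < g n`
there. -/
theorem StrictMonoOn.lt_apply_of_one_lt {g : ℕ → ℕ} (hg : StrictMonoOn g (Set.Ici 1))
    (h1 : 1 < g 1) {n : ℕ} (hn : 1 ≤ n) : n < g n := by
  induction n, hn using Nat.le_induction with
  | base => exact h1
  | succ n hn ih =>
    have : g n < g (n + 1) :=
      hg (Set.mem_Ici.2 hn) (Set.mem_Ici.2 (Nat.le_succ_of_le hn)) n.lt_add_one
    omega


/-- **Splitting theorem (Theorem 1).**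
Here the positive integers are `{n : ℕ | 1 ≤ n}`, `A` is an infinite set of positive
integers with `1 ∉ A`, `B̄ = {n | 1 ≤ n} \ A`, and `g` is the increasing enumeration of `A`
(`g n` is the `n`-th smallest element of `A` for `n ≥ 1`).  The ray started at `a₀` is
`r_{a₀} = {g^[n] a₀ : n ≥ 1}`.  The rays started from points of `B̄` are pairwise disjoint
and their union equals `A`. -/
theorem splitting_theorem (A : Set ℕ) (g : ℕ → ℕ)
    (hApos : ∀ a ∈ A, 1 ≤ a) (hAinf : A.Infinite) (hA1 : 1 ∉ A)
    (hgmono : StrictMonoOn g (Set.Ici 1))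
    (hgrange : g '' Set.Ici 1 = A) :
    (∀ a₀ ∈ {n : ℕ | 1 ≤ n} \ A, ∀ b₀ ∈ {n : ℕ | 1 ≤ n} \ A, a₀ ≠ b₀ →
        {x : ℕ | ∃ n ≥ 1, x = g^[n] a₀} ∩ {x : ℕ | ∃ n ≥ 1, x = g^[n] b₀} = ∅) ∧
    (⋃ a₀ ∈ {n : ℕ | 1 ≤ n} \ A, {x : ℕ | ∃ n ≥ 1, x = g^[n] a₀}) = A := by
  subst hgrange
  have hmaps : Set.MapsTo g (Set.Ici 1) (Set.Ici 1) := fun n hn => hApos _ ⟨n, hn, rfl⟩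
  have h1 : 1 < g 1 := lt_of_le_of_ne (hmaps Set.self_mem_Ici)
    fun h => hA1 ⟨1, Set.self_mem_Ici, h.symm⟩
  refine ⟨fun a ha b hb hab => ?_, Set.Subset.antisymm ?_ ?_⟩
  · rw [Set.eq_empty_iff_forall_notMem]
    rintro x ⟨⟨n, -, hn⟩, ⟨m, -, hm⟩⟩
    exact hab (eq_of_iterate_eq_of_notMem_image hgmono.injOn hmaps ha hb (hn.symm.trans hm))
  · refine Set.iUnion₂_subset fun a ha => ?_
    rintro x ⟨n, hn, rfl⟩
    obtain ⟨k, rfl⟩ := Nat.exists_eq_add_of_le' hn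
    exact ⟨_, hmaps.iterate k ha.1, (Function.iterate_succ_apply' g k a).symm⟩
  · rintro _ ⟨y, hy, rfl⟩
    obtain ⟨a, ha, n, rfl⟩ :=
      exists_iterate_eq_of_forall_lt (fun x hx => hgmono.lt_apply_of_one_lt h1 hx) hy
    exact Set.mem_iUnion₂.2
      ⟨a, ha, n + 1, Nat.le_add_left 1 n, (Function.iterate_succ_apply' g n a).symm⟩
end

section
/- Corollary 3 of the splitting theorem (counting formula): let a₀¹, a₀² ∈ B̄ and ν₁, ν₂ ≥ 1, and put a = g^{ν₁}(a₀¹), b = g^{ν₂}(a₀²). If a < b, then the number of elements of A lying strictly between a and b equals g^{ν₂−1}(a₀²) − g^{ν₁−1}(a₀¹) − 1; that is, #{x ∈ A : a < x < b} = g^{ν₂−1}(a₀²) − g^{ν₁−1}(a₀¹) − 1. -/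
/-- A function that is strictly increasing on `Set.Ici 1` has exactly `q - p - 1` values strictly
between `g p` and `g q`. -/
theorem ncard_image_Ici_one_between {g : ℕ → ℕ} (hg : StrictMonoOn g (Set.Ici 1)) {p q : ℕ}
    (hp : 1 ≤ p) (hq : 1 ≤ q) :
    {x : ℕ | x ∈ g '' Set.Ici 1 ∧ g p < x ∧ x < g q}.ncard = q - p - 1 := by
  have himage : {x : ℕ | x ∈ g '' Set.Ici 1 ∧ g p < x ∧ x < g q} = g '' Set.Ioo p q := by
    ext x
    constructor
    · rintro ⟨⟨n, hn, rfl⟩, hpn, hnq⟩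
      exact ⟨n, ⟨(hg.lt_iff_lt hp hn).1 hpn, (hg.lt_iff_lt hn hq).1 hnq⟩, rfl⟩
    · rintro ⟨n, ⟨hpn, hnq⟩, rfl⟩
      have hn : n ∈ Set.Ici 1 := hp.trans hpn.le
      exact ⟨⟨n, hn, rfl⟩, hg hp hn hpn, hg hn hq hnq⟩
  have hsub : Set.Ioo p q ⊆ Set.Ici 1 := fun _ hn => hp.trans hn.1.le
  rw [himage, (hg.injOn.mono hsub).ncard_image, ← Finset.coe_Ioo,
    Set.ncard_coe_finset, Nat.card_Ioo]

/-- **Corollary 3 of the splitting theorem (counting formula).**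
Let `a₀¹, a₀² ∈ B̄ = {n | 1 ≤ n} \ A` and `ν₁, ν₂ ≥ 1`, and put `a = g^[ν₁] a₀¹`,
`b = g^[ν₂] a₀²`.  If `a < b`, then the number of elements of `A` lying strictly between
`a` and `b` equals `g^[ν₂-1] a₀² - g^[ν₁-1] a₀¹ - 1`. -/
theorem splitting_corollary_three (A : Set ℕ) (g : ℕ → ℕ)
    (hApos : ∀ a ∈ A, 1 ≤ a) (hAinf : A.Infinite) (hA1 : 1 ∉ A)
    (hgmono : StrictMonoOn g (Set.Ici 1))
    (hgrange : g '' Set.Ici 1 = A)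
    (a₀₁ a₀₂ : ℕ) (ha₀₁ : a₀₁ ∈ {n : ℕ | 1 ≤ n} \ A) (ha₀₂ : a₀₂ ∈ {n : ℕ | 1 ≤ n} \ A)
    (ν₁ ν₂ : ℕ) (hν₁ : 1 ≤ ν₁) (hν₂ : 1 ≤ ν₂)
    (hab : g^[ν₁] a₀₁ < g^[ν₂] a₀₂) :
    {x : ℕ | x ∈ A ∧ g^[ν₁] a₀₁ < x ∧ x < g^[ν₂] a₀₂}.ncard =
      g^[ν₂ - 1] a₀₂ - g^[ν₁ - 1] a₀₁ - 1 := by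
  have hmaps : Set.MapsTo g (Set.Ici 1) (Set.Ici 1) := fun n hn =>
    hApos _ (hgrange ▸ Set.mem_image_of_mem g hn)
  obtain ⟨k, rfl⟩ := Nat.exists_eq_add_of_le' hν₁
  obtain ⟨l, rfl⟩ := Nat.exists_eq_add_of_le' hν₂
  subst hgrange
  simp only [Function.iterate_succ_apply', Nat.add_sub_cancel]
  exact ncard_image_Ici_one_between hgmono (hmaps.iterate k ha₀₁.1) (hmaps.iterate l ha₀₂.1)
end

section
/- Splitting theorem for the primes: for m ∈ M̄ define the Eratosthenes ray r_m = {pⁿ(m) : n ≥ 1}. Then the rays r_m, m ∈ M̄, are pairwise disjoint (r_{m₁} ∩ r_{m₂} = ∅ whenever m₁ ≠ m₂ are in M̄), and their union ⋃_{m ∈ M̄} r_m equals the set of all primes. -/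
/-- `p n` is the `n`-th prime number, indexed from 1: `p 1 = 2`, `p 2 = 3`, `p 3 = 5`, … -/
noncomputable def p (n : ℕ) : ℕ := Nat.nth Nat.Prime (n - 1)

theorem prime_p (n : ℕ) : (p n).Prime := Nat.prime_nth_prime _

theorem lt_p {n : ℕ} (hn : 1 ≤ n) : n < p n := by
  have := Nat.add_two_le_nth_prime (n - 1)
  unfold p
  omega

theorem p_injOn {a b : ℕ} (ha : 1 ≤ a) (hb : 1 ≤ b) (h : p a = p b) : a = b := by
  have := Nat.nth_injective Nat.infinite_setOfPred_prime h
  omega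

theorem exists_p_eq {q : ℕ} (hq : q.Prime) : ∃ k ≥ 1, p k = q :=
  ⟨Nat.count Nat.Prime q + 1, Nat.le_add_left _ _, Nat.nth_count hq⟩

theorem one_le_iterate_p {m : ℕ} (hm : 1 ≤ m) (n : ℕ) : 1 ≤ p^[n] m := by
  cases n with
  | zero => exact hm
  | succ n => rw [Function.iterate_succ_apply']; exact (prime_p _).one_le

theorem eq_of_iterate_p_eq {m₁ m₂ : ℕ} (h₁ : 1 ≤ m₁) (h₁' : ¬ m₁.Prime) (h₂ : 1 ≤ m₂)
    (h₂' : ¬ m₂.Prime) (a b : ℕ) (h : p^[a] m₁ = p^[b] m₂) : m₁ = m₂ := by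
  induction a generalizing b with
  | zero =>
    cases b with
    | zero => exact h
    | succ b =>
      rw [Function.iterate_succ_apply', Function.iterate_zero_apply] at h
      exact absurd (h ▸ prime_p _) h₁'
  | succ a ih =>
    cases b with
    | zero =>
      rw [Function.iterate_succ_apply', Function.iterate_zero_apply] at h
      exact absurd (h ▸ prime_p _) h₂'
    | succ b =>
      rw [Function.iterate_succ_apply', Function.iterate_succ_apply'] at h
      exact ih b (p_injOn (one_le_iterate_p h₁ a) (one_le_iterate_p h₂ b) h)

theorem exists_iterate_p_eq {q : ℕ} (hq : q.Prime) :
    ∃ m, (1 ≤ m ∧ ¬ m.Prime) ∧ ∃ n ≥ 1, q = p^[n] m := by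
  induction q using Nat.strong_induction_on with
  | _ q ih =>
    obtain ⟨k, hk, rfl⟩ := exists_p_eq hq
    by_cases hkp : k.Prime
    · obtain ⟨m, hm, n, -, hn⟩ := ih k (lt_p hk) hkp
      exact ⟨m, hm, n + 1, Nat.le_add_left _ _, by rw [Function.iterate_succ_apply', ← hn]⟩
    · exact ⟨k, ⟨hk, hkp⟩, 1, le_rfl, rfl⟩

/-- **Splitting theorem for the primes.**
`M̄ = {m | 1 ≤ m ∧ ¬ m.Prime}` is the set of positive integers that are not prime
(`1` together with the composite numbers).  For `m ∈ M̄`, the Eratosthenes ray is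
`r_m = {p^[n] m : n ≥ 1}`.  The rays `r_m`, `m ∈ M̄`, are pairwise disjoint, and their
union equals the set of all primes. -/
theorem prime_splitting :
    (∀ m₁ ∈ {m : ℕ | 1 ≤ m ∧ ¬ m.Prime}, ∀ m₂ ∈ {m : ℕ | 1 ≤ m ∧ ¬ m.Prime}, m₁ ≠ m₂ →
        {x : ℕ | ∃ n ≥ 1, x = p^[n] m₁} ∩ {x : ℕ | ∃ n ≥ 1, x = p^[n] m₂} = ∅) ∧
    (⋃ m ∈ {m : ℕ | 1 ≤ m ∧ ¬ m.Prime}, {x : ℕ | ∃ n ≥ 1, x = p^[n] m}) =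
      {q : ℕ | q.Prime} := by
  refine ⟨?_, ?_⟩
  · rintro m₁ ⟨h₁, h₁'⟩ m₂ ⟨h₂, h₂'⟩ hne
    rw [Set.eq_empty_iff_forall_notMem]
    rintro x ⟨⟨a, -, ha⟩, b, -, hb⟩
    exact hne (eq_of_iterate_p_eq h₁ h₁' h₂ h₂' a b (ha.symm.trans hb))
  · ext q
    simp only [Set.mem_iUnion, Set.mem_ofPred_eq, exists_prop]
    constructor
    · rintro ⟨m, -, n, hn, rfl⟩
      obtain ⟨k, rfl⟩ := Nat.exists_eq_add_of_le' hn
      rw [Function.iterate_succ_apply']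
      exact prime_p _
    · exact exists_iterate_p_eq
end

section
/- Collinearity criterion on the logarithmic spiral (equation (17) of the paper): fix 0 < x < 1 (x = cos φ for some 0 < φ < π/2), and for a real number u ≥ 0 let P_u = ((ux+1) cos θ_u, (ux+1) sin θ_u) ∈ ℝ², where θ_u = √(1/x² − 1) · ln(ux + 1) (so P_u is the point of the spiral ρ_φ at arc length u). For u, v ≥ 0 define S_{uv}(x) = (ux+1)(vx+1) · sin( √(1/x² − 1) · ln((ux+1)/(vx+1)) ). Then for all a, b, c ≥ 0, the three points P_a, P_b, P_c are collinear in ℝ² if and only if S_{ab}(x) + S_{bc}(x) + S_{ca}(x) = 0. -/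
/-- Three points of the plane are collinear iff the signed area of their triangle vanishes. -/
theorem collinear_triple_iff_cross_eq_zero (p q r : ℝ × ℝ) :
    Collinear ℝ ({p, q, r} : Set (ℝ × ℝ)) ↔
      (p.2 * q.1 - p.1 * q.2) + (q.2 * r.1 - q.1 * r.2) + (r.2 * p.1 - r.1 * p.2) = 0 := by
  obtain ⟨p₁, p₂⟩ := p
  obtain ⟨q₁, q₂⟩ := q
  obtain ⟨r₁, r₂⟩ := r
  rw [collinear_iff_of_mem (p₀ := (p₁, p₂)) (by simp)]
  simp only [Set.mem_insert_iff, Set.mem_singleton_iff, forall_eq_or_imp, forall_eq, vadd_eq_add,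
    Prod.exists, Prod.smul_mk, Prod.mk_add_mk, Prod.mk.injEq, smul_eq_mul]
  constructor
  · rintro ⟨v₁, v₂, -, ⟨s, rfl, rfl⟩, t, rfl, rfl⟩
    ring
  · intro h
    by_cases hpq : q₁ = p₁ ∧ q₂ = p₂
    · obtain ⟨rfl, rfl⟩ := hpq
      exact ⟨r₁ - q₁, r₂ - q₂, ⟨0, by simp⟩, ⟨0, by simp⟩, 1, by ring, by ring⟩
    · have hN : (q₁ - p₁) ^ 2 + (q₂ - p₂) ^ 2 ≠ 0 := by
        intro hN
        apply hpq
        constructor <;> nlinarith [sq_nonneg (q₁ - p₁), sq_nonneg (q₂ - p₂)]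
      refine ⟨q₁ - p₁, q₂ - p₂, ⟨0, by simp⟩, ⟨1, by ring, by ring⟩,
        ((r₁ - p₁) * (q₁ - p₁) + (r₂ - p₂) * (q₂ - p₂)) /
          ((q₁ - p₁) ^ 2 + (q₂ - p₂) ^ 2), ?_, ?_⟩
      · field_simp
        linear_combination (q₂ - p₂) * h
      · field_simp
        linear_combination (p₁ - q₁) * h


/-- **Collinearity criterion on the logarithmic spiral (equation (17) of the paper).**
Fix `0 < x < 1` (`x = cos φ` for some `0 < φ < π/2`).  For `u ≥ 0` let
`θ_u = √(1/x² - 1) · ln (u x + 1)` and let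
`P u = ((u x + 1) cos θ_u, (u x + 1) sin θ_u) ∈ ℝ²` be the point of the spiral `ρ_φ` at
arc length `u`.  For `u, v ≥ 0` define
`S u v = (u x + 1)(v x + 1) · sin (√(1/x² - 1) · ln ((u x + 1)/(v x + 1)))`.
Then for all `a, b, c ≥ 0`, the points `P a`, `P b`, `P c` are collinear in `ℝ²` iff
`S a b + S b c + S c a = 0`. -/
theorem log_spiral_collinearity (x : ℝ) (hx₀ : 0 < x) (hx₁ : x < 1)
    (θ : ℝ → ℝ) (hθ : ∀ u : ℝ, θ u = Real.sqrt (1 / x ^ 2 - 1) * Real.log (u * x + 1))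
    (P : ℝ → ℝ × ℝ)
    (hP : ∀ u : ℝ, P u = ((u * x + 1) * Real.cos (θ u), (u * x + 1) * Real.sin (θ u)))
    (S : ℝ → ℝ → ℝ)
    (hS : ∀ u v : ℝ, S u v = (u * x + 1) * (v * x + 1) *
        Real.sin (Real.sqrt (1 / x ^ 2 - 1) * Real.log ((u * x + 1) / (v * x + 1))))
    (a b c : ℝ) (ha : 0 ≤ a) (hb : 0 ≤ b) (hc : 0 ≤ c) :
    Collinear ℝ ({P a, P b, P c} : Set (ℝ × ℝ)) ↔ S a b + S b c + S c a = 0 := by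
  have hS' : ∀ u v : ℝ, 0 ≤ u → 0 ≤ v →
      S u v = (P u).2 * (P v).1 - (P u).1 * (P v).2 := by
    intro u v hu hv
    have hu' : u * x + 1 ≠ 0 := by positivity
    have hv' : v * x + 1 ≠ 0 := by positivity
    rw [hS, Real.log_div hu' hv', mul_sub, ← hθ, ← hθ, Real.sin_sub, hP, hP]
    ring
  rw [collinear_triple_iff_cross_eq_zero, hS' a b ha hb, hS' b c hb hc, hS' c a hc ha]
end
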